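/- For all integers n ≥ 1, k ≥ 0 and every l with 1 ≤ l ≤ k, one has p^l_{n,n+k;≤n+k} = p^{l+1}_{n,n+k;≤n+k}; that is, p^1_{n,n+k;≤n+k} = p^2_{n,n+k;≤n+k} = … = p^{k+1}_{n,n+k;≤n+k}. -/

import Mathlib

/-- One parking step: a car with preference `a` parks in the first unoccupied
space `j` with `a ≤ j ≤ m`, if such a space exists; otherwise it leaves. -/
def parkStep (m : ℕ) (occ : Finset ℕ) (a : ℕ) : Finset ℕ :=
  if h : ((Finset.Icc a m) \ occ).Nonempty then
    insert (((Finset.Icc a m) \ occ).min' h) occ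
  else occ

/-- The set of occupied spaces after the cars with preference list `l`
(in order of arrival) have tried to park among spaces `1, …, m`. -/
def occupied (m : ℕ) (l : List ℕ) : Finset ℕ := l.foldl (parkStep m) ∅

/-- The number of cars that leave unparked. -/
def flaws (m : ℕ) (l : List ℕ) : ℕ := l.length - (occupied m l).card

/-- The preference list (with entries in `[1, s]`) encoded by a function `Fin n → Fin s`. -/
def prefList {n s : ℕ} (f : Fin n → Fin s) : List ℕ :=
  (List.ofFn f).map (fun i => (i : ℕ) + 1)

/-- `p n m s k` is the number of `k`-flaw preference sets of length `n` with `m`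
parking spaces, all of whose entries are at most `s`. -/
def p (n m s k : ℕ) : ℕ :=
  (Finset.univ.filter (fun f : Fin n → Fin s => flaws m (prefList f) = k)).card

/-- `pL n m s k l` is the number of `k`-flaw preference sets of length `n` with `m`
parking spaces, entries at most `s`, and first entry `l`. -/
def pL (n m s k l : ℕ) : ℕ :=
  (Finset.univ.filter (fun f : Fin n → Fin s =>
    flaws m (prefList f) = k ∧ (prefList f).head? = some l)).card

/-- The set of empty spaces. -/
def empties (m : ℕ) (l : List ℕ) : Finset ℕ := Finset.Icc 1 m \ occupied m l

/-- `n_α`: the number of entries equal to the first entry. -/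
def nstat (l : List ℕ) : ℕ := l.count l.headI

/-- `h_α`: the number of empty spaces smaller than the first entry. -/
def hstat (m : ℕ) (l : List ℕ) : ℕ := ((empties m l).filter (fun x => x < l.headI)).card

/-- `τ_α`: the number of entries smaller than the first entry, plus one. -/
def taustat (l : List ℕ) : ℕ := l.countP (fun a => a < l.headI) + 1

/-- `m_α`: the largest empty space. -/
def mstat (m : ℕ) (l : List ℕ) : ℕ := (empties m l).sup id

theorem occ_append (m : ℕ) (L : List ℕ) (a : ℕ) :
    occupied m (L ++ [a]) = parkStep m (occupied m L) a := by
  simp [occupied, List.foldl_append]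

/-- Description of one parking step. -/
theorem parkStep_cases (m : ℕ) (O : Finset ℕ) (a : ℕ) :
    (parkStep m O a = O ∧ ∀ x, a ≤ x → x ≤ m → x ∈ O) ∨
    ∃ j, a ≤ j ∧ j ≤ m ∧ j ∉ O ∧ (∀ x, a ≤ x → x < j → x ∈ O) ∧ parkStep m O a = insert j O := by
  unfold parkStep
  split_ifs with h
  · right
    have hm := Finset.min'_mem _ h
    simp only [Finset.mem_sdiff, Finset.mem_Icc] at hm
    refine ⟨_, hm.1.1, hm.1.2, hm.2, ?_, rfl⟩
    intro x hax hxj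
    by_contra hx
    have := Finset.min'_le (Finset.Icc a m \ O) x (by
      simp only [Finset.mem_sdiff, Finset.mem_Icc]
      exact ⟨⟨hax, by omega⟩, hx⟩)
    omega
  · left
    refine ⟨rfl, fun x hx1 hx2 => ?_⟩
    by_contra hx
    exact h ⟨x, by simp [hx1, hx2, hx]⟩

theorem occ_sub (m : ℕ) (L : List ℕ) (hL : ∀ a ∈ L, 1 ≤ a) :
    occupied m L ⊆ Finset.Icc 1 m := by
  induction L using List.reverseRecOn with
  | nil => simp [occupied]
  | append_singleton L a ih =>
    have ih := ih (fun b hb => hL b (by simp [hb]))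
    have ha := hL a (by simp)
    rw [occ_append]
    rcases parkStep_cases m (occupied m L) a with ⟨h, _⟩ | ⟨j, h1, h2, _, _, h⟩
    · rw [h]; exact ih
    · rw [h]
      refine Finset.insert_subset ?_ ih
      simp; omega

theorem occ_card_le (m : ℕ) (L : List ℕ) : (occupied m L).card ≤ L.length := by
  induction L using List.reverseRecOn with
  | nil => simp [occupied]
  | append_singleton L a ih =>
    rw [occ_append]
    rcases parkStep_cases m (occupied m L) a with ⟨h, _⟩ | ⟨j, h1, h2, h3, _, h⟩
    · rw [h]; simp; omega
    · rw [h, Finset.card_insert_of_notMem h3]; simp; omega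

/-- If everybody parks, cars preferring `≥ t` are in spaces `≥ t`. -/
theorem count_le (m t : ℕ) (L : List ℕ) (hf : L.length ≤ (occupied m L).card) :
    L.countP (fun a => t ≤ a) ≤ ((occupied m L).filter (fun x => t ≤ x)).card := by
  induction L using List.reverseRecOn with
  | nil => simp
  | append_singleton L a ih =>
    rw [occ_append] at hf ⊢
    have hc := occ_card_le m L
    rcases parkStep_cases m (occupied m L) a with ⟨h, _⟩ | ⟨j, h1, h2, h3, _, h⟩
    · rw [h] at hf; simp at hf; omega
    · rw [h, Finset.card_insert_of_notMem h3] at hf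
      simp only [List.length_append, List.length_singleton] at hf
      have ih := ih (by omega)
      rw [h, Finset.filter_insert, List.countP_append, List.countP_singleton]
      have h3' : j ∉ (occupied m L).filter (fun x => t ≤ x) := by simp [h3]
      by_cases hta : t ≤ a
      · rw [if_pos (by omega : t ≤ j), Finset.card_insert_of_notMem h3']
        simp [hta]; exact ih
      · rw [if_neg (by simpa using hta)]
        split_ifs
        · rw [Finset.card_insert_of_notMem h3']; omega
        · omega

/-- If space `t` is empty, spaces `> t` are only filled by cars preferring `> t`. -/
theorem le_count (m t : ℕ) (L : List ℕ) (ht : t ∉ occupied m L) :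
    ((occupied m L).filter (fun x => t + 1 ≤ x)).card ≤ L.countP (fun a => t + 1 ≤ a) := by
  induction L using List.reverseRecOn with
  | nil => simp [occupied]
  | append_singleton L a ih =>
    rw [occ_append] at ht ⊢
    rw [List.countP_append, List.countP_singleton]
    rcases parkStep_cases m (occupied m L) a with ⟨h, _⟩ | ⟨j, h1, h2, h3, h4, h⟩
    · rw [h] at ht ⊢
      have := ih ht
      omega
    · rw [h] at ht ⊢
      simp only [Finset.mem_insert, not_or] at ht
      have ih := ih ht.2
      rw [Finset.filter_insert]
      have h3' : j ∉ (occupied m L).filter (fun x => t + 1 ≤ x) := by simp [h3]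
      split_ifs with h5 h6
      · rw [Finset.card_insert_of_notMem h3']; omega
      · exfalso
        simp only [decide_eq_true_eq] at h6
        exact ht.2 (h4 t (by omega) (by omega))
      · omega
      · omega

theorem park_iff (m : ℕ) (L : List ℕ) (hL : ∀ a ∈ L, 1 ≤ a ∧ a ≤ m) :
    flaws m L = 0 ↔ ∀ t, 1 ≤ t → t ≤ m → L.countP (fun a => t ≤ a) ≤ m + 1 - t := by
  have hflaw : flaws m L = 0 ↔ L.length ≤ (occupied m L).card := by
    unfold flaws; omega
  rw [hflaw]
  constructor
  · intro h t ht1 htm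
    refine (count_le m t L h).trans ?_
    rw [← Nat.card_Icc]
    apply Finset.card_le_card
    intro x hx
    have hs := occ_sub m L (fun a ha => (hL a ha).1)
    simp only [Finset.mem_filter] at hx
    have := hs hx.1
    simp at this ⊢
    omega
  · intro h
    induction L using List.reverseRecOn with
    | nil => simp
    | append_singleton L a ih =>
      have hL' : ∀ b ∈ L, 1 ≤ b ∧ b ≤ m := fun b hb => hL b (by simp [hb])
      have ha := hL a (by simp)
      have ih := ih hL' (by unfold flaws; omega) (fun t h1 h2 => by
        have := h t h1 h2
        rw [List.countP_append] at this
        omega)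
      rw [occ_append]
      rcases parkStep_cases m (occupied m L) a with ⟨h', hfull⟩ | ⟨j, h1, h2, h3, h4, h'⟩
      · exfalso
        have h0 : 0 ∉ occupied m L := by
          intro h0
          have := occ_sub m L (fun a ha => (hL' a ha).1) h0
          simp at this
        -- largest empty space below `a`
        obtain ⟨t, hta, ht, hbt⟩ : ∃ t, t < a ∧ t ∉ occupied m L ∧
            ∀ x, t < x → x ≤ m → x ∈ occupied m L := by
          by_contra hcon
          push Not at hcon
          have key : ∀ d, ∀ x, a ≤ x + d → x ≤ m → x ∈ occupied m L := by
            intro d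
            induction d with
            | zero => intro x hx hxm; exact hfull x (by omega) hxm
            | succ d ihd =>
              intro x hx hxm
              by_cases hxa : a ≤ x + d
              · exact ihd x hxa hxm
              · by_contra hxO
                obtain ⟨y, hy1, hy2, hy3⟩ := hcon x (by omega) hxO
                exact hy3 (ihd y (by omega) hy2)
          exact h0 (key a 0 (by omega) (by omega))
        have hc := le_count m t L ht
        have h6 := h (t + 1) (by omega) (by omega)
        rw [List.countP_append, List.countP_singleton,
          if_pos (by simp; omega)] at h6
        have h7 : (Finset.Icc (t + 1) m).card ≤
            ((occupied m L).filter (fun x => t + 1 ≤ x)).card := by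
          apply Finset.card_le_card
          intro x hx
          simp only [Finset.mem_Icc] at hx
          simp only [Finset.mem_filter]
          exact ⟨hbt x (by omega) hx.2, hx.1⟩
        rw [Nat.card_Icc] at h7
        omega
      · rw [h', Finset.card_insert_of_notMem h3]
        simpa using ih

theorem prefList_eq {n s : ℕ} (f : Fin n → Fin s) :
    prefList f = List.ofFn (fun i => (f i : ℕ) + 1) := by
  unfold prefList
  rw [show (do let a ← List.ofFn f; pure (a : ℕ)) = (List.ofFn f).map (fun a : Fin s => (a : ℕ)) from
    List.flatMap_pure_eq_map _ _]
  rw [List.map_map, List.map_ofFn]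
  rfl

theorem prefList_cons {n s : ℕ} (f : Fin (n + 1) → Fin s) :
    prefList f = ((f 0 : ℕ) + 1) :: prefList (Fin.tail f) := by
  simp [prefList_eq, List.ofFn_succ, Fin.tail]

theorem prefList_mem {n s : ℕ} (f : Fin n → Fin s) : ∀ a ∈ prefList f, 1 ≤ a ∧ a ≤ s := by
  intro a ha
  simp only [prefList_eq, List.mem_ofFn] at ha
  obtain ⟨i, rfl⟩ := ha
  have := (f i).2
  omega

theorem pL_eq (n m l : ℕ) (hl : 1 ≤ l) (hlm : l ≤ m) :
    pL (n + 1) m m 0 l =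
      (Finset.univ.filter (fun g : Fin n → Fin m => flaws m (l :: prefList g) = 0)).card := by
  unfold pL
  refine Finset.card_bij' (fun f _ => Fin.tail f)
    (fun g _ => Fin.cons (⟨l - 1, by omega⟩ : Fin m) g) ?_ ?_ ?_ ?_
  · intro f hf
    simp only [Finset.mem_filter, Finset.mem_univ, true_and, prefList_cons, List.head?_cons,
      Option.some.injEq] at hf ⊢
    rw [← hf.2]; exact hf.1
  · intro g hg
    simp only [Finset.mem_filter, Finset.mem_univ, true_and, prefList_cons, List.head?_cons,
      Option.some.injEq, Fin.cons_zero, Fin.tail_cons] at hg ⊢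
    rw [Nat.sub_add_cancel hl]
    exact ⟨hg, rfl⟩
  · intro f hf
    simp only [Finset.mem_filter, Finset.mem_univ, true_and, prefList_cons, List.head?_cons,
      Option.some.injEq] at hf
    have : (⟨l - 1, by omega⟩ : Fin m) = f 0 := by
      apply Fin.ext
      simp only
      omega
    simp only [this]
    exact Fin.cons_self_tail f
  · intro g hg
    simp

/-- Theorem 4.1: for `n ≥ 1`, `k ≥ 0` and `1 ≤ l ≤ k`,
`p^l_{n,n+k;≤n+k} = p^{l+1}_{n,n+k;≤n+k}`. -/
theorem stmt1 (n k l : ℕ) (hn : 1 ≤ n) (hl1 : 1 ≤ l) (hlk : l ≤ k) :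
    pL n (n + k) (n + k) 0 l = pL n (n + k) (n + k) 0 (l + 1) := by
  obtain ⟨n, rfl⟩ : ∃ n', n = n' + 1 := ⟨n - 1, by omega⟩
  rw [pL_eq _ _ _ hl1 (by omega), pL_eq _ _ _ (by omega) (by omega)]
  congr 1
  apply Finset.filter_congr
  intro g _
  have hg := prefList_mem g
  have hlen : (prefList g).length = n := by simp [prefList_eq]
  rw [park_iff, park_iff]
  · refine forall_congr' fun t => ?_
    refine imp_congr_right fun ht1 => imp_congr_right fun htm => ?_
    have hc := List.countP_le_length (p := fun a => decide (t ≤ a)) (l := prefList g)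
    rw [List.countP_cons, List.countP_cons]
    simp only [decide_eq_true_eq]
    split_ifs <;> omega
  · intro a ha
    rcases List.mem_cons.1 ha with rfl | ha
    · omega
    · exact hg a ha
  · intro a ha
    rcases List.mem_cons.1 ha with rfl | ha
    · omega
    · exact hg a ha
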